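/- (Pointwise bound for a maximum of affine functions.) Work in ℝ^n with the Euclidean inner product ⟨·,·⟩, a norm ‖·‖ and its dual norm ‖·‖_*. Let Ξ = {ξ ∈ ℝ^n : C_ξ ξ ≤ d_ξ} be a polytope, and let ℓ(ξ) = max_{1 ≤ t ≤ T} (⟨a_t, ξ⟩ + b_t) with a_t ∈ ℝ^n, b_t ∈ ℝ. Let ξ̂ ∈ ℝ^n, λ ≥ 0 and s ∈ ℝ, and suppose that for each t there exists γ_t ∈ ℝ^m with γ_t ≥ 0 componentwise, b_t + ⟨a_t, ξ̂⟩ + ⟨γ_t, d_ξ − C_ξ ξ̂⟩ ≤ s, and ‖C_ξ^⊤ γ_t − a_t‖_* ≤ λ. Then ℓ(ξ) ≤ s + λ ‖ξ − ξ̂‖ for every ξ ∈ Ξ. -/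

import Mathlib

open Matrix Finset

/-- The dual norm `‖y‖_* = sup {⟨y,x⟩ : ‖x‖ ≤ 1}` of a norm `nrm` on `ℝ^n`. -/
noncomputable def dualNorm {n : ℕ} (nrm : (Fin n → ℝ) → ℝ) (y : Fin n → ℝ) : ℝ :=
  sSup {r : ℝ | ∃ x : Fin n → ℝ, nrm x ≤ 1 ∧ r = dotProduct y x}

/-- A linear functional on a finite-dimensional normed space is bounded. -/
theorem LinearMap.exists_le_mul_norm {E : Type*} [NormedAddCommGroup E] [NormedSpace ℝ E]
    [FiniteDimensional ℝ E] (f : E →ₗ[ℝ] ℝ) : ∃ C, 0 ≤ C ∧ ∀ x, f x ≤ C * ‖x‖ :=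
  ⟨‖LinearMap.toContinuousLinearMap f‖, norm_nonneg _, fun x =>
    (le_abs_self _).trans ((LinearMap.toContinuousLinearMap f).le_opNorm x)⟩

section DualNorm

variable {n : ℕ} {nrm : (Fin n → ℝ) → ℝ}

/-- A subadditive, absolutely homogeneous function is nonnegative. -/
theorem nonneg_of_add_le_of_smul
    (h_add : ∀ x y : Fin n → ℝ, nrm (x + y) ≤ nrm x + nrm y)
    (h_smul : ∀ (r : ℝ) (x : Fin n → ℝ), nrm (r • x) = |r| * nrm x)
    (x : Fin n → ℝ) : 0 ≤ nrm x := by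
  have h := h_add x ((-1 : ℝ) • x)
  have h_zero : nrm (x + (-1 : ℝ) • x) = 0 := by
    simpa using h_smul 0 x
  rw [h_zero, h_smul] at h
  norm_num at h
  linarith

/-- For every norm on `ℝ^n`, the linear functional `⟨y, ·⟩` is bounded. -/
theorem exists_dotProduct_le_mul
    (h_add : ∀ x y : Fin n → ℝ, nrm (x + y) ≤ nrm x + nrm y)
    (h_smul : ∀ (r : ℝ) (x : Fin n → ℝ), nrm (r • x) = |r| * nrm x)
    (h_eq_zero : ∀ x : Fin n → ℝ, nrm x = 0 ↔ x = 0) (y : Fin n → ℝ) :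
    ∃ C, 0 ≤ C ∧ ∀ x, y ⬝ᵥ x ≤ C * nrm x := by
  let N : AddGroupNorm (Fin n → ℝ) :=
    { toFun := nrm
      map_zero' := (h_eq_zero 0).2 rfl
      add_le' := h_add
      neg' := fun x => by simpa using h_smul (-1) x
      eq_zero_of_map_eq_zero' := fun x => (h_eq_zero x).1 }
  let G : NormedAddCommGroup (Fin n → ℝ) := N.toNormedAddCommGroup
  let S : @NormedSpace ℝ (Fin n → ℝ) _ G.toSeminormedAddCommGroup :=
    @NormedSpace.mk ℝ (Fin n → ℝ) _ G.toSeminormedAddCommGroup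
      (inferInstanceAs (Module ℝ (Fin n → ℝ))) (fun r x => (h_smul r x).le)
  exact @LinearMap.exists_le_mul_norm (Fin n → ℝ) G S
    (inferInstanceAs (FiniteDimensional ℝ (Fin n → ℝ))) (dotProductBilin ℝ ℝ y)

/-- Hölder's inequality for a norm and its dual norm. -/
theorem dotProduct_le_dualNorm_mul
    (h_add : ∀ x y : Fin n → ℝ, nrm (x + y) ≤ nrm x + nrm y)
    (h_smul : ∀ (r : ℝ) (x : Fin n → ℝ), nrm (r • x) = |r| * nrm x)
    (h_eq_zero : ∀ x : Fin n → ℝ, nrm x = 0 ↔ x = 0) (y x : Fin n → ℝ) :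
    y ⬝ᵥ x ≤ dualNorm nrm y * nrm x := by
  obtain rfl | hx := eq_or_ne x 0
  · simp [(h_eq_zero 0).2 rfl]
  have hpos : 0 < nrm x :=
    (nonneg_of_add_le_of_smul h_add h_smul x).lt_of_ne' fun h => hx ((h_eq_zero x).1 h)
  obtain ⟨C, hC, hbound⟩ := exists_dotProduct_le_mul h_add h_smul h_eq_zero y
  have hbdd : BddAbove {r : ℝ | ∃ x : Fin n → ℝ, nrm x ≤ 1 ∧ r = y ⬝ᵥ x} := by
    refine ⟨C, ?_⟩
    rintro _ ⟨z, hz, rfl⟩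
    exact (hbound z).trans (mul_le_of_le_one_right hC hz)
  have hunit : nrm ((nrm x)⁻¹ • x) ≤ 1 := by
    rw [h_smul, abs_of_pos (inv_pos.2 hpos), inv_mul_cancel₀ hpos.ne']
  have hle : y ⬝ᵥ ((nrm x)⁻¹ • x) ≤ dualNorm nrm y := le_csSup hbdd ⟨_, hunit, rfl⟩
  rwa [dotProduct_smul, smul_eq_mul, inv_mul_le_iff₀ hpos, mul_comm] at hle

end DualNorm

/-- **pointwise bound for a maximum of affine functions.** Let
`Ξ = {ξ : C_ξ ξ ≤ d_ξ}`, `ℓ(ξ) = max_{1 ≤ t ≤ T} (⟨a_t, ξ⟩ + b_t)`, and let `ξ̂`, `λ ≥ 0`,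
`s` be such that for each `t` there exists `γ_t ≥ 0` with
`b_t + ⟨a_t, ξ̂⟩ + ⟨γ_t, d_ξ − C_ξ ξ̂⟩ ≤ s` and `‖C_ξᵀ γ_t − a_t‖_* ≤ λ`. Then
`ℓ(ξ) ≤ s + λ ‖ξ − ξ̂‖` for every `ξ ∈ Ξ`. -/
theorem pointwise_bound_max_affine
    {n m T : ℕ} (hT : 0 < T) (nrm : (Fin n → ℝ) → ℝ)
    (h_add : ∀ x y : Fin n → ℝ, nrm (x + y) ≤ nrm x + nrm y)
    (h_smul : ∀ (r : ℝ) (x : Fin n → ℝ), nrm (r • x) = |r| * nrm x)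
    (h_eq_zero : ∀ x : Fin n → ℝ, nrm x = 0 ↔ x = 0)
    (Cξ : Matrix (Fin m) (Fin n) ℝ) (dξ : Fin m → ℝ)
    (a : Fin T → Fin n → ℝ) (b : Fin T → ℝ) (ξhat : Fin n → ℝ)
    (lam : ℝ) (hlam : 0 ≤ lam) (s : ℝ)
    (hγ : ∀ t : Fin T, ∃ γ : Fin m → ℝ,
      (∀ i, 0 ≤ γ i) ∧
      b t + dotProduct (a t) ξhat
          + dotProduct γ (dξ - Cξ.mulVec ξhat) ≤ s ∧
      dualNorm nrm (Cξ.transpose.mulVec γ - a t) ≤ lam) :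
    ∀ ξ : Fin n → ℝ, (∀ i, Cξ.mulVec ξ i ≤ dξ i) →
      (Finset.univ.sup' (⟨⟨0, hT⟩, Finset.mem_univ _⟩ : (Finset.univ : Finset (Fin T)).Nonempty)
          fun t => dotProduct (a t) ξ + b t)
        ≤ s + lam * nrm (ξ - ξhat) := by
  intro ξ hξ
  refine Finset.sup'_le _ _ fun t _ => ?_
  obtain ⟨γ, hγ_nonneg, hs, hdual⟩ := hγ t
  have hslack : 0 ≤ γ ⬝ᵥ (dξ - Cξ *ᵥ ξ) :=
    Finset.sum_nonneg fun i _ => mul_nonneg (hγ_nonneg i) (sub_nonneg.2 (hξ i))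
  have hholder :=
    dotProduct_le_dualNorm_mul h_add h_smul h_eq_zero (Cξᵀ *ᵥ γ - a t) (ξhat - ξ)
  have hsymm : nrm (ξhat - ξ) = nrm (ξ - ξhat) := by
    simpa using h_smul (-1) (ξ - ξhat)
  have hlam_mul := mul_le_mul_of_nonneg_right hdual
    (nonneg_of_add_le_of_smul h_add h_smul (ξ - ξhat))
  rw [hsymm] at hholder
  simp only [sub_dotProduct, dotProduct_sub, mulVec_transpose, ← dotProduct_mulVec]
    at hholder hs hslack
  simp only [mulVec_transpose] at hlam_mul
  linarith
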